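/- Let G₂ ⊂ GL(2,ℂ) be the subgroup generated by ((I₂)ᵀ)⁻¹ and ((ωτ)ᵀ)⁻¹ (the action of the binary tetrahedral group on the representation S₂). For every nonzero vector v = (v₁,v₂) ∈ ℂ², the stabilizer of v in G₂ is nontrivial if and only if v₁⁴ + 2q v₁²v₂² + v₂⁴ = 0; that is, the locus of points of S₂ with nontrivial isotropy group is the curve C₂ cut out by this quartic. -/

import Mathlib

/-!
STATEMENT 11: Let G₂ ⊂ GL(2,ℂ) be the subgroup generated by ((I₂)ᵀ)⁻¹ and
((ωτ)ᵀ)⁻¹ (the action of the binary tetrahedral group on the representation S₂).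
For every nonzero vector v = (v₁,v₂) ∈ ℂ², the stabilizer of v in G₂ is nontrivial
if and only if v₁⁴ + 2q v₁²v₂² + v₂⁴ = 0; i.e. the locus of points of S₂ with
nontrivial isotropy group is the curve C₂ cut out by this quartic.
-/

noncomputable section

open Matrix

/-- ω = e^{2πi/3} -/
noncomputable def ω : ℂ := Complex.exp (2 * Real.pi * Complex.I / 3)

/-- q = 2ω+1, a square root of -3 -/
noncomputable def q : ℂ := 2 * ω + 1

/-- I₂ = [[i,0],[0,-i]] -/
def I₂ : Matrix (Fin 2) (Fin 2) ℂ := !![Complex.I, 0; 0, -Complex.I]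

/-- τ = -(1/2)·[[1+i, -1+i],[1+i, 1-i]] -/
def τ : Matrix (Fin 2) (Fin 2) ℂ :=
  -(1 / 2 : ℂ) • !![1 + Complex.I, -1 + Complex.I; 1 + Complex.I, 1 - Complex.I]

/-- The matrix of `t/2` times the quaternion `a + b i + c j + d k`. -/
def qm (t : ℂ) (a b c d : ℤ) : Matrix (Fin 2) (Fin 2) ℂ :=
  !![t / 2 * (a + b * Complex.I), t / 2 * (c + d * Complex.I);
     t / 2 * (-c + d * Complex.I), t / 2 * (a - b * Complex.I)]

theorem omega_quad : ω ^ 2 + ω + 1 = 0 := by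
  have h := (Complex.isPrimitiveRoot_exp 3 (by norm_num)).geom_sum_eq_zero (by norm_num)
  simp only [Finset.sum_range_succ, Finset.sum_range_zero] at h
  have e : ω = Complex.exp (2 * Real.pi * Complex.I / (3 : ℕ)) := by
    unfold ω; norm_num
  rw [← e] at h
  linear_combination h

theorem omega_cube : ω ^ 3 = 1 := by
  linear_combination (ω - 1) * omega_quad

theorem omega_pow_mod (k : ℕ) : ω ^ (k % 3) = ω ^ k := by
  conv_rhs => rw [← Nat.div_add_mod k 3, pow_add, pow_mul, omega_cube, one_pow, one_mul]

theorem qm_mul (s t : ℂ) (a b c d a' b' c' d' x y z w : ℤ)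
    (hx : 2 * x = a * a' - b * b' - c * c' - d * d')
    (hy : 2 * y = a * b' + b * a' + c * d' - d * c')
    (hz : 2 * z = a * c' - b * d' + c * a' + d * b')
    (hw : 2 * w = a * d' + b * c' - c * b' + d * a') :
    qm s a b c d * qm t a' b' c' d' = qm (s * t) x y z w := by
  have hx' : (2 : ℂ) * x = a * a' - b * b' - c * c' - d * d' := by exact_mod_cast hx
  have hy' : (2 : ℂ) * y = a * b' + b * a' + c * d' - d * c' := by exact_mod_cast hy
  have hz' : (2 : ℂ) * z = a * c' - b * d' + c * a' + d * b' := by exact_mod_cast hz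
  have hw' : (2 : ℂ) * w = a * d' + b * c' - c * b' + d * a' := by exact_mod_cast hw
  have hI : Complex.I ^ 2 = -1 := Complex.I_sq
  ext i j
  fin_cases i <;> fin_cases j <;> simp [qm, Matrix.mul_apply, Fin.sum_univ_two]
  · linear_combination (-s * t / 4) * (hx' + Complex.I * hy') +
      s * t / 4 * ((b : ℂ) * b' + d * d') * hI
  · linear_combination (-s * t / 4) * (hz' + Complex.I * hw') +
      s * t / 4 * ((b : ℂ) * d' - d * b') * hI
  · linear_combination (-s * t / 4) * (-hz' + Complex.I * hw') +
      s * t / 4 * ((d : ℂ) * b' - b * d') * hI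
  · linear_combination (-s * t / 4) * (hx' - Complex.I * hy') +
      s * t / 4 * ((b : ℂ) * b' + d * d') * hI

/-- The 24 group elements: the power of `ω`, and twice the quaternion. -/
def els : List (ℕ × ℤ × ℤ × ℤ × ℤ) :=
  ([1, -1] : List ℤ).flatMap (fun s =>
    [(0, 2 * s, 0, 0, 0), (0, 0, 2 * s, 0, 0), (0, 0, 0, 2 * s, 0), (0, 0, 0, 0, 2 * s)] ++
    ([1, -1] : List ℤ).flatMap (fun b => ([1, -1] : List ℤ).flatMap (fun c =>
      [(1, s, b, c, s * b * c), (2, s, b, c, -(s * b * c))])))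

/-- The matrix attached to an entry of the list. -/
def toM (x : ℕ × ℤ × ℤ × ℤ × ℤ) : Matrix (Fin 2) (Fin 2) ℂ :=
  qm (ω ^ x.1) x.2.1 x.2.2.1 x.2.2.2.1 x.2.2.2.2

/-- `z = x y` in terms of the encoding. -/
def isProd (x y z : ℕ × ℤ × ℤ × ℤ × ℤ) : Prop :=
  (x.1 + y.1) % 3 = z.1 ∧
  2 * z.2.1 = x.2.1 * y.2.1 - x.2.2.1 * y.2.2.1 - x.2.2.2.1 * y.2.2.2.1
    - x.2.2.2.2 * y.2.2.2.2 ∧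
  2 * z.2.2.1 = x.2.1 * y.2.2.1 + x.2.2.1 * y.2.1 + x.2.2.2.1 * y.2.2.2.2
    - x.2.2.2.2 * y.2.2.2.1 ∧
  2 * z.2.2.2.1 = x.2.1 * y.2.2.2.1 - x.2.2.1 * y.2.2.2.2 + x.2.2.2.1 * y.2.1
    + x.2.2.2.2 * y.2.2.1 ∧
  2 * z.2.2.2.2 = x.2.1 * y.2.2.2.2 + x.2.2.1 * y.2.2.2.1 - x.2.2.2.1 * y.2.2.1
    + x.2.2.2.2 * y.2.1

instance (x y z : ℕ × ℤ × ℤ × ℤ × ℤ) : Decidable (isProd x y z) := by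
  unfold isProd; infer_instance

theorem toM_mul {x y z : ℕ × ℤ × ℤ × ℤ × ℤ} (h : isProd x y z) :
    toM x * toM y = toM z := by
  obtain ⟨h0, h1, h2, h3, h4⟩ := h
  unfold toM
  rw [qm_mul _ _ _ _ _ _ _ _ _ _ _ _ _ _ h1 h2 h3 h4, ← pow_add, ← omega_pow_mod, h0]

theorem toM_one : toM (0, 2, 0, 0, 0) = 1 := by
  ext i j
  fin_cases i <;> fin_cases j <;> simp [toM, qm]

theorem els_closed : ∀ g ∈ [((0, 0, -2, 0, 0) : ℕ × ℤ × ℤ × ℤ × ℤ), (0, 0, 2, 0, 0),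
    (2, -1, 1, 1, 1), (1, -1, -1, -1, -1)], ∀ x ∈ els, ∃ y ∈ els, isProd g x y := by
  decide

theorem I2_inv_eq : (I₂ᵀ)⁻¹ = toM (0, 0, -2, 0, 0) := by
  apply Matrix.inv_eq_right_inv
  ext i j
  fin_cases i <;> fin_cases j <;> simp [toM, qm, I₂, Matrix.mul_apply, Fin.sum_univ_two]

theorem tau_eq : (ω • τ)ᵀ = toM (1, -1, -1, -1, -1) := by
  ext i j
  fin_cases i <;> fin_cases j <;> simp [toM, qm, τ] <;> ring

theorem inv_two : ((ω • τ)ᵀ)⁻¹ = toM (2, -1, 1, 1, 1) := by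
  apply Matrix.inv_eq_right_inv
  rw [tau_eq, ← toM_one]
  exact toM_mul (by decide)

theorem coe_inv_of (B : GL (Fin 2) ℂ) {x y : ℕ × ℤ × ℤ × ℤ × ℤ}
    (h : (B : Matrix (Fin 2) (Fin 2) ℂ) = toM x) (hp : isProd x y (0, 2, 0, 0, 0)) :
    ((B⁻¹ : GL (Fin 2) ℂ) : Matrix (Fin 2) (Fin 2) ℂ) = toM y := by
  rw [Matrix.coe_units_inv, h]
  apply Matrix.inv_eq_right_inv
  rw [toM_mul hp, toM_one]

theorem mem_els (B₁ B₂ : GL (Fin 2) ℂ)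
    (h1 : (B₁ : Matrix (Fin 2) (Fin 2) ℂ) = toM (0, 0, -2, 0, 0))
    (h2 : (B₂ : Matrix (Fin 2) (Fin 2) ℂ) = toM (2, -1, 1, 1, 1))
    (g : GL (Fin 2) ℂ) (hg : g ∈ Subgroup.closure {B₁, B₂}) :
    ∃ x ∈ els, (g : Matrix (Fin 2) (Fin 2) ℂ) = toM x := by
  have h1i := coe_inv_of B₁ (y := (0, 0, 2, 0, 0)) h1 (by decide)
  have h2i := coe_inv_of B₂ (y := (1, -1, -1, -1, -1)) h2 (by decide)
  have key : ∀ (b : GL (Fin 2) ℂ), ∀ e ∈ [((0, 0, -2, 0, 0) : ℕ × ℤ × ℤ × ℤ × ℤ),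
      (0, 0, 2, 0, 0), (2, -1, 1, 1, 1), (1, -1, -1, -1, -1)],
      (b : Matrix (Fin 2) (Fin 2) ℂ) = toM e → ∀ y : GL (Fin 2) ℂ,
      (∃ x ∈ els, (y : Matrix (Fin 2) (Fin 2) ℂ) = toM x) →
      ∃ x ∈ els, ((b * y : GL (Fin 2) ℂ) : Matrix (Fin 2) (Fin 2) ℂ) = toM x := by
    rintro b e he hb y ⟨x, hx, hy⟩
    obtain ⟨z, hz, hp⟩ := els_closed e he x hx
    exact ⟨z, hz, by rw [Units.val_mul, hb, hy, toM_mul hp]⟩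
  induction hg using Subgroup.closure_induction_left with
  | one => exact ⟨(0, 2, 0, 0, 0), by decide, by rw [toM_one]; rfl⟩
  | mul_left x hx y hy ih =>
    rcases hx with rfl | rfl
    · exact key _ _ (by simp) h1 _ ih
    · exact key _ _ (by simp) h2 _ ih
  | inv_mul_cancel x hx y hy ih =>
    rcases hx with rfl | rfl
    · exact key _ _ (by simp) h1i _ ih
    · exact key _ _ (by simp) h2i _ ih

theorem q_sq : q ^ 2 = -3 := by
  unfold q
  linear_combination 4 * omega_quad

/-- A fixed vector of a reflection lies on the quartic. -/
theorem quartic_of_eq (e : ℂ) (b c d : ℤ) (x y : ℂ) (he : e ^ 2 = 1) (hb : b ^ 2 = 1)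
    (hc : c ^ 2 = 1) (hd : d ^ 2 = 1) (h : (b * c * d : ℂ) = e)
    (E : (c + d * Complex.I) * y = (e * q - b * Complex.I) * x) :
    x ^ 4 + 2 * q * x ^ 2 * y ^ 2 + y ^ 4 = 0 := by
  have hb' : (b : ℂ) ^ 2 = 1 := by exact_mod_cast hb
  have hc' : (c : ℂ) ^ 2 = 1 := by exact_mod_cast hc
  have hd' : (d : ℂ) ^ 2 = 1 := by exact_mod_cast hd
  have hI : Complex.I ^ 2 = -1 := Complex.I_sq
  have hq := q_sq
  have hcd : (c * d : ℂ) = e * b := by linear_combination (b : ℂ) * h - (c * d : ℂ) * hb'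
  have E2 : (2 * (e * b) * Complex.I) * y ^ 2 = (-4 - 2 * e * b * q * Complex.I) * x ^ 2 := by
    have : ((c + d * Complex.I) * y) ^ 2 = ((e * q - b * Complex.I) * x) ^ 2 := by rw [E]
    have l : (c + d * Complex.I) ^ 2 = 2 * (e * b) * Complex.I := by
      linear_combination hc' - hd' + (d : ℂ) ^ 2 * hI + 2 * Complex.I * hcd
    have r : (e * q - b * Complex.I) ^ 2 = -4 - 2 * e * b * q * Complex.I := by
      linear_combination q ^ 2 * he + hq + (b : ℂ) ^ 2 * hI - hb'
    rw [mul_pow, mul_pow, l, r] at this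
    exact this
  have heb : (e * b) ^ 2 = 1 := by rw [mul_pow, he, hb', one_mul]
  have E3 : y ^ 2 + q * x ^ 2 = 2 * (e * b) * Complex.I * x ^ 2 := by
    linear_combination (-(e * b) * Complex.I / 2) * E2 +
      (y ^ 2 + q * x ^ 2) * (Complex.I ^ 2 * heb + hI)
  linear_combination (y ^ 2 + q * x ^ 2 + 2 * (e * b) * Complex.I * x ^ 2) * E3 -
    x ^ 4 * hq + 4 * x ^ 4 * (Complex.I ^ 2 * heb + hI)

theorem els_norm : ∀ x ∈ els, x.2.1 ^ 2 + x.2.2.1 ^ 2 + x.2.2.2.1 ^ 2 + x.2.2.2.2 ^ 2 = 4 ∧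
    (x.1 = 0 ∧ (x.2.1 = 2 → x = (0, 2, 0, 0, 0)) ∨
     x.1 = 1 ∧ x.2.2.1 ^ 2 = 1 ∧ x.2.2.2.1 ^ 2 = 1 ∧ x.2.2.2.2 ^ 2 = 1 ∧
      (x.2.1 = -1 → x.2.2.1 * x.2.2.2.1 * x.2.2.2.2 = -1) ∨
     x.1 = 2 ∧ x.2.2.1 ^ 2 = 1 ∧ x.2.2.2.1 ^ 2 = 1 ∧ x.2.2.2.2 ^ 2 = 1 ∧
      (x.2.1 = -1 → x.2.2.1 * x.2.2.2.1 * x.2.2.2.2 = 1)) := by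
  decide

theorem trace_cond (t : ℂ) (a b c d : ℤ) (v : Fin 2 → ℂ) (hv : v ≠ 0)
    (hn : a ^ 2 + b ^ 2 + c ^ 2 + d ^ 2 = 4)
    (h0 : t / 2 * (a + b * Complex.I) * v 0 + t / 2 * (c + d * Complex.I) * v 1 = v 0)
    (h1 : t / 2 * (-c + d * Complex.I) * v 0 + t / 2 * (a - b * Complex.I) * v 1 = v 1) :
    t * a = 1 + t ^ 2 := by
  have hn' : (a : ℂ) ^ 2 + b ^ 2 + c ^ 2 + d ^ 2 = 4 := by exact_mod_cast hn
  have hI : Complex.I ^ 2 = -1 := Complex.I_sq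
  have e0 : (1 + t ^ 2 - t * a) * v 0 = 0 := by
    linear_combination (t / 2 * (a - b * Complex.I) - 1) * h0 -
      t / 2 * (c + d * Complex.I) * h1 - t ^ 2 / 4 * v 0 * hn' +
      t ^ 2 / 4 * v 0 * ((b : ℂ) ^ 2 + d ^ 2) * hI
  have e1 : (1 + t ^ 2 - t * a) * v 1 = 0 := by
    linear_combination (t / 2 * (a + b * Complex.I) - 1) * h1 -
      t / 2 * (-c + d * Complex.I) * h0 - t ^ 2 / 4 * v 1 * hn' +
      t ^ 2 / 4 * v 1 * ((b : ℂ) ^ 2 + d ^ 2) * hI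
  by_contra hne
  have hne' : 1 + t ^ 2 - t * a ≠ 0 := fun h => hne (by linear_combination -h)
  apply hv
  ext i
  fin_cases i
  · simpa [hne'] using e0
  · simpa [hne'] using e1

theorem forward (x : ℕ × ℤ × ℤ × ℤ × ℤ) (hx : x ∈ els) (v : Fin 2 → ℂ) (hv : v ≠ 0)
    (hM : toM x ≠ 1) (hf : (toM x).mulVec v = v) :
    v 0 ^ 4 + 2 * q * v 0 ^ 2 * v 1 ^ 2 + v 1 ^ 4 = 0 := by
  obtain ⟨hn, hc⟩ := els_norm x hx
  obtain ⟨k, a, b, c, d⟩ := x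
  have h0 := congrFun hf 0
  have h1 := congrFun hf 1
  simp only [toM, qm, Matrix.mulVec, dotProduct, Fin.sum_univ_two, Matrix.of_apply,
    Matrix.cons_val_zero, Matrix.cons_val_one, Matrix.cons_val', Matrix.cons_val_fin_one]
    at h0 h1 hn hc
  have ht := trace_cond _ a b c d v hv hn h0 h1
  have hw := omega_quad
  have hw0 : ω ≠ 0 := by
    intro h
    rw [h] at hw
    norm_num at hw
  rcases hc with ⟨rfl, hc⟩ | ⟨rfl, hb, hc, hd, hs⟩ | ⟨rfl, hb, hc, hd, hs⟩
  · exfalso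
    apply hM
    have : (a : ℂ) = 2 := by linear_combination ht
    rw [hc (by exact_mod_cast this), toM_one]
  · have : (a : ℂ) = -1 := by
      apply mul_left_cancel₀ hw0
      linear_combination ht + hw
    have hs' := hs (by exact_mod_cast this)
    refine quartic_of_eq (-1) b c d _ _ (by norm_num) hb hc hd (by exact_mod_cast hs') ?_
    rw [this] at h0
    unfold q
    linear_combination 2 * ω ^ 2 * h0 + (-(b * Complex.I * v 0) + v 0 - (c + d * Complex.I) * v 1) *
      omega_cube + 2 * v 0 * hw
  · have : (a : ℂ) = -1 := by
      apply mul_left_cancel₀ (pow_ne_zero 2 hw0)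
      linear_combination ht + hw + ω * omega_cube
    have hs' := hs (by exact_mod_cast this)
    refine quartic_of_eq 1 b c d _ _ (by norm_num) hb hc hd (by exact_mod_cast hs') ?_
    rw [this] at h0
    unfold q
    linear_combination 2 * ω * h0 + (-(b * Complex.I * v 0) + v 0 - (c + d * Complex.I) * v 1) *
      omega_cube

/-- The linear equation of a mirror gives a fixed vector. -/
theorem fixed_of_eq (b c d : ℤ) (v : Fin 2 → ℂ) (hb : b ^ 2 = 1)
    (hc : c ^ 2 = 1) (hd : d ^ 2 = 1)
    (E : (c + d * Complex.I) * v 1 = (q - b * Complex.I) * v 0) :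
    (toM (2, -1, b, c, d)).mulVec v = v := by
  have hb' : (b : ℂ) ^ 2 = 1 := by exact_mod_cast hb
  have hc' : (c : ℂ) ^ 2 = 1 := by exact_mod_cast hc
  have hd' : (d : ℂ) ^ 2 = 1 := by exact_mod_cast hd
  have hI : Complex.I ^ 2 = -1 := Complex.I_sq
  have hq := q_sq
  have E' : (-c + d * Complex.I) * v 0 = (q + b * Complex.I) * v 1 := by
    have hne : (q - b * Complex.I) ≠ 0 := by
      intro h
      have : q ^ 2 = (b * Complex.I) ^ 2 := by rw [sub_eq_zero.mp h]
      rw [hq, mul_pow, hb', hI] at this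
      norm_num at this
    apply mul_left_cancel₀ hne
    linear_combination -(-c + d * Complex.I) * E - v 1 * hc' - v 1 * hd' + v 1 * (d : ℂ) ^ 2 * hI
      - v 1 * hq + v 1 * (b : ℂ) ^ 2 * hI - v 1 * hb'
  have hw : 2 * ω + 1 = q := rfl
  ext i
  fin_cases i
  · simp [toM, qm, Matrix.mulVec, dotProduct, Fin.sum_univ_two]
    rw [← hw] at E
    linear_combination ω ^ 2 / 2 * E + v 0 * omega_cube
  · simp [toM, qm, Matrix.mulVec, dotProduct, Fin.sum_univ_two]
    rw [← hw] at E'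
    linear_combination ω ^ 2 / 2 * E' + v 1 * omega_cube

theorem exists_mirror (x y : ℂ) (h : x ^ 4 + 2 * q * x ^ 2 * y ^ 2 + y ^ 4 = 0) :
    ∃ p ∈ [((1, 1, 1) : ℤ × ℤ × ℤ), (1, -1, -1), (-1, 1, -1), (-1, -1, 1)],
      (p.2.1 + p.2.2 * Complex.I) * y = (q - p.1 * Complex.I) * x := by
  have hI : Complex.I ^ 2 = -1 := Complex.I_sq
  have hq := q_sq
  have hf : (y ^ 2 + q * x ^ 2 - 2 * Complex.I * x ^ 2) *
      (y ^ 2 + q * x ^ 2 + 2 * Complex.I * x ^ 2) = 0 := by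
    linear_combination h + x ^ 4 * hq - 4 * x ^ 4 * hI
  rcases mul_eq_zero.mp hf with h1 | h1
  · have h2 : ((1 + Complex.I) * y) ^ 2 = ((q - Complex.I) * x) ^ 2 := by
      linear_combination 2 * Complex.I * h1 + (y ^ 2 + 3 * x ^ 2) * hI - x ^ 2 * hq
    rcases sq_eq_sq_iff_eq_or_eq_neg.mp h2 with h3 | h3
    · exact ⟨(1, 1, 1), by simp, by push_cast; linear_combination h3⟩
    · exact ⟨(1, -1, -1), by simp, by push_cast; linear_combination -h3⟩
  · have h2 : ((1 - Complex.I) * y) ^ 2 = ((q + Complex.I) * x) ^ 2 := by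
      linear_combination -2 * Complex.I * h1 + (y ^ 2 + 3 * x ^ 2) * hI - x ^ 2 * hq
    rcases sq_eq_sq_iff_eq_or_eq_neg.mp h2 with h3 | h3
    · exact ⟨(-1, 1, -1), by simp, by push_cast; linear_combination h3⟩
    · exact ⟨(-1, -1, 1), by simp, by push_cast; linear_combination -h3⟩

theorem toM_ne_one (b c d : ℤ) (hc : c ^ 2 = 1) :
    toM (2, -1, b, c, d) ≠ 1 := by
  intro h
  have h01 := congrFun (congrFun h 0) 1
  have h10 := congrFun (congrFun h 1) 0
  simp only [toM, qm, Matrix.of_apply, Matrix.cons_val_zero, Matrix.cons_val_one,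
    Matrix.cons_val', Matrix.cons_val_fin_one, Matrix.one_apply] at h01 h10
  norm_num at h01 h10
  have hc' : (c : ℂ) ^ 2 = 1 := by exact_mod_cast hc
  have hw := omega_quad
  rcases h01 with h01 | h01
  · rw [h01] at hw
    norm_num at hw
  · rcases h10 with h10 | h10
    · rw [h10] at hw
      norm_num at hw
    · have : (c : ℂ) = 0 := by linear_combination (h01 - h10) / 2
      rw [this] at hc'
      norm_num at hc'

theorem mirror_mem (B₁ B₂ : GL (Fin 2) ℂ)
    (h1 : (B₁ : Matrix (Fin 2) (Fin 2) ℂ) = toM (0, 0, -2, 0, 0))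
    (h2 : (B₂ : Matrix (Fin 2) (Fin 2) ℂ) = toM (2, -1, 1, 1, 1)) (p : ℤ × ℤ × ℤ)
    (hp : p ∈ [((1, 1, 1) : ℤ × ℤ × ℤ), (1, -1, -1), (-1, 1, -1), (-1, -1, 1)]) :
    ∃ g ∈ Subgroup.closure {B₁, B₂},
      (g : Matrix (Fin 2) (Fin 2) ℂ) = toM (2, -1, p.1, p.2.1, p.2.2) := by
  have h1i := coe_inv_of B₁ (y := (0, 0, 2, 0, 0)) h1 (by decide)
  have h2i := coe_inv_of B₂ (y := (1, -1, -1, -1, -1)) h2 (by decide)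
  have m1 : B₁ ∈ Subgroup.closure {B₁, B₂} := Subgroup.subset_closure (by simp)
  have m2 : B₂ ∈ Subgroup.closure {B₁, B₂} := Subgroup.subset_closure (by simp)
  have hC : ((B₁ * B₂ * B₁⁻¹ : GL (Fin 2) ℂ) : Matrix (Fin 2) (Fin 2) ℂ)
      = toM (2, -1, 1, -1, -1) := by
    rw [Units.val_mul, Units.val_mul, h1, h2, h1i,
      toM_mul (z := (2, 1, 1, 1, -1)) (by decide)]
    exact toM_mul (by decide)
  have mC := mul_mem (mul_mem m1 m2) (inv_mem m1)
  simp only [List.mem_cons, List.not_mem_nil, or_false] at hp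
  rcases hp with rfl | rfl | rfl | rfl
  · exact ⟨B₂, m2, h2⟩
  · exact ⟨_, mC, hC⟩
  · refine ⟨_, mul_mem (mul_mem (inv_mem m2) mC) m2, ?_⟩
    rw [Units.val_mul, Units.val_mul, hC, h2, h2i,
      toM_mul (z := (0, 0, 0, 0, 2)) (by decide)]
    exact toM_mul (by decide)
  · refine ⟨_, mul_mem (mul_mem m2 mC) (inv_mem m2), ?_⟩
    rw [Units.val_mul, Units.val_mul, hC, h2, h2i,
      toM_mul (z := (1, 1, -1, 1, -1)) (by decide)]
    exact toM_mul (by decide)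

theorem nontrivial_isotropy_iff_on_quartic_curve
    (B₁ B₂ : GL (Fin 2) ℂ)
    (hB₁ : (B₁ : Matrix (Fin 2) (Fin 2) ℂ) = (I₂ᵀ)⁻¹)
    (hB₂ : (B₂ : Matrix (Fin 2) (Fin 2) ℂ) = ((ω • τ)ᵀ)⁻¹) :
    ∀ v : Fin 2 → ℂ, v ≠ 0 →
      ((∃ g ∈ Subgroup.closure {B₁, B₂}, g ≠ 1 ∧
          (g : Matrix (Fin 2) (Fin 2) ℂ).mulVec v = v)
        ↔ v 0 ^ 4 + 2 * q * v 0 ^ 2 * v 1 ^ 2 + v 1 ^ 4 = 0) := by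
  intro v hv
  rw [I2_inv_eq] at hB₁
  rw [inv_two] at hB₂
  constructor
  · rintro ⟨g, hg, hg1, hf⟩
    obtain ⟨x, hx, hgx⟩ := mem_els B₁ B₂ hB₁ hB₂ g hg
    rw [hgx] at hf
    refine forward x hx v hv ?_ hf
    intro h
    apply hg1
    ext1
    rw [hgx, h]
    rfl
  · intro h
    obtain ⟨p, hp, E⟩ := exists_mirror _ _ h
    obtain ⟨g, hg, hgM⟩ := mirror_mem B₁ B₂ hB₁ hB₂ p hp
    have hsq : p.1 ^ 2 = 1 ∧ p.2.1 ^ 2 = 1 ∧ p.2.2 ^ 2 = 1 := by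
      simp only [List.mem_cons, List.not_mem_nil, or_false] at hp
      rcases hp with rfl | rfl | rfl | rfl <;> norm_num
    refine ⟨g, hg, ?_, ?_⟩
    · rintro rfl
      exact toM_ne_one _ _ _ hsq.2.1 (hgM.symm.trans rfl)
    · rw [hgM]
      exact fixed_of_eq _ _ _ v hsq.1 hsq.2.1 hsq.2.2 E

end
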